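/- Let d ≥ 3, o ∈ {0,1}, μ > 0 a real number, and let r, N be integers with 1 ≤ r ≤ r̄(d) and N ≥ 0 (with r ≥ o). If a is a smooth function on ℝ^d such that for every multi-index α there is C_α > 0 with |∂^α a(x)| ≤ C_α ⟨x⟩^{−μ−o−|α|} for all x, then ‖a‖_{o,r−o,N} < ∞; moreover there is a constant C, depending only on d, r, N, μ, o, such that ‖a‖_{o,r−o,N} ≤ C · max_{|α| ≤ N + r − o} sup_{x ∈ ℝ^d} ⟨x⟩^{μ+o+|α|} |∂^α a(x)|. (This expresses the symbol class embeddings S^{−μ} ⊂ S^{0,r,N} and S^{−μ−1} ⊂ S^{1,r−1,N}.) -/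

import Mathlib

open MeasureTheory Complex Finset
open scoped ENNReal

noncomputable section

abbrev Euc (d : ℕ) := EuclideanSpace ℝ (Fin d)

/-- Partial derivative `∂_j` of a complex-valued function on `ℝ^d`. -/
def pd {d : ℕ} (j : Fin d) (u : Euc d → ℂ) : Euc d → ℂ :=
  fun x => fderiv ℝ u x (EuclideanSpace.single j 1)

/-- Iterated partial derivative `∂^α` for a multi-index `α`. -/
def pdAlpha {d : ℕ} (α : Fin d → ℕ) (u : Euc d → ℂ) : Euc d → ℂ :=
  (List.finRange d).foldr (fun j v => (pd j)^[α j] v) u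

/-- The Laplacian `Δ = Σ_j ∂_j²`. -/
def lap {d : ℕ} (u : Euc d → ℂ) : Euc d → ℂ :=
  fun x => ∑ j, pd j (pd j u) x

/-- The operator `x·∇`. -/
def xGrad {d : ℕ} (u : Euc d → ℂ) : Euc d → ℂ :=
  fun x => ∑ j, (x j : ℂ) * pd j u x

/-- Multi-indices `α` on `Fin d` with `|α| ≤ r`. -/
def multiIndices (d r : ℕ) : Finset (Fin d → ℕ) :=
  (Fintype.piFinset fun _ : Fin d => Finset.range (r + 1)).filter
    (fun α => ∑ i, α i ≤ r)

/-- The norm `‖a‖_{o,r,N} = Σ_{n ≤ N, |α| ≤ r} ‖∂^α (x·∇)^n a‖_{L^{d/(o+|α|)}}`,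
with the convention `L^{d/0} = L^∞` (in `ℝ≥0∞`, `d/0 = ∞`). -/
def coefNorm (d o r N : ℕ) (a : Euc d → ℂ) : ℝ≥0∞ :=
  ∑ n ∈ Finset.range (N + 1), ∑ α ∈ multiIndices d r,
    eLpNorm (pdAlpha α ((xGrad (d := d))^[n] a))
      ((d : ℝ≥0∞) / ((o + ∑ i, α i : ℕ) : ℝ≥0∞)) volume

/-- The Sobolev norm `‖v‖_{H^m} = Σ_{|α| ≤ m} ‖∂^α v‖_{L²}`. -/
def sobNorm (d s : ℕ) (u : Euc d → ℂ) : ℝ≥0∞ :=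
  ∑ α ∈ multiIndices d s, eLpNorm (pdAlpha α u) 2 volume

/-- `D_j = -i ∂_j`. -/
def Dop {d : ℕ} (j : Fin d) (u : Euc d → ℂ) : Euc d → ℂ :=
  fun x => -Complex.I * pd j u x

/-- The operator `P u = Σ_{j,k} a_{jk} D_j D_k u + Σ_k b_k D_k u`. -/
def Pop {d : ℕ} (a : Fin d → Fin d → Euc d → ℂ) (b : Fin d → Euc d → ℂ)
    (u : Euc d → ℂ) : Euc d → ℂ :=
  fun x => (∑ j, ∑ k, a j k x * Dop j (Dop k u) x) + ∑ k, b k x * Dop k u x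

/-- The generator of dilations `A = (x·∇)/i + d/2`. -/
def Aop {d : ℕ} (u : Euc d → ℂ) : Euc d → ℂ :=
  fun x => -Complex.I * xGrad u x + ((d : ℂ) / 2) * u x

/-- Iterated commutators `ad_A^0 T = T`, `ad_A^{n+1} T = (ad_A^n T) A - A (ad_A^n T)`. -/
def adA {d : ℕ} : ℕ → ((Euc d → ℂ) → (Euc d → ℂ)) → ((Euc d → ℂ) → (Euc d → ℂ))
  | 0, T => T
  | n + 1, T => fun u x => adA n T (Aop u) x - Aop (adA n T u) x

/-- `P` is symmetric on Schwartz functions. -/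
def IsSymmP {d : ℕ} (a : Fin d → Fin d → Euc d → ℂ) (b : Fin d → Euc d → ℂ) : Prop :=
  ∀ u v : SchwartzMap (Euc d) ℂ,
    ∫ x, Pop a b u x * (starRingEnd ℂ) (v x) = ∫ x, u x * (starRingEnd ℂ) (Pop a b v x)

/-- Smooth with all derivatives bounded. -/
def CinftyBdd {d : ℕ} (f : Euc d → ℂ) : Prop :=
  ContDiff ℝ (⊤ : ℕ∞) f ∧ ∀ n : ℕ, ∃ C : ℝ, ∀ x, ‖iteratedFDeriv ℝ n f x‖ ≤ C

/-- `r̄(d)`: the largest integer strictly smaller than `d/2`. -/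
def rbar (d : ℕ) : ℕ := (d - 1) / 2

/-- `‖∇u‖_{L²} = (Σ_j ‖∂_j u‖_{L²}²)^{1/2}`. -/
def gradNorm {d : ℕ} (u : Euc d → ℂ) : ℝ≥0∞ :=
  (∑ j, eLpNorm (pd j u) 2 volume ^ 2) ^ (1 / 2 : ℝ)

/-- `‖∇u‖_{L²}²` as a real number, for Schwartz `u`. -/
def gradSq {d : ℕ} (u : Euc d → ℂ) : ℝ :=
  ∑ j, ∫ x, ‖pd j u x‖ ^ 2

/-- Japanese bracket `⟨x⟩ = (1+|x|²)^{1/2}`. -/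
def jap {d : ℕ} (x : Euc d) : ℝ := Real.sqrt (1 + ‖x‖ ^ 2)


lemma ContDiff.pd {d : ℕ} {u : Euc d → ℂ} (hu : ContDiff ℝ (⊤ : ℕ∞) u) (j : Fin d) :
    ContDiff ℝ (⊤ : ℕ∞) (pd j u) := by
  have h : ContDiff ℝ (⊤ : ℕ∞) (fderiv ℝ u) := hu.fderiv_right (by simp)
  exact h.clm_apply contDiff_const

lemma ContDiff.iterate_pd {d : ℕ} {u : Euc d → ℂ} (hu : ContDiff ℝ (⊤ : ℕ∞) u) (j : Fin d)
    (k : ℕ) : ContDiff ℝ (⊤ : ℕ∞) ((_root_.pd j)^[k] u) := by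
  induction k with
  | zero => exact hu
  | succ k ih => rw [Function.iterate_succ_apply']; exact ih.pd j

lemma ContDiff.foldr_pd {d : ℕ} {u : Euc d → ℂ} (hu : ContDiff ℝ (⊤ : ℕ∞) u) (α : Fin d → ℕ)
    (L : List (Fin d)) :
    ContDiff ℝ (⊤ : ℕ∞) (L.foldr (fun j v => (_root_.pd j)^[α j] v) u) := by
  induction L with
  | nil => exact hu
  | cons i L ih => exact ih.iterate_pd i _

lemma ContDiff.pdAlpha {d : ℕ} {u : Euc d → ℂ} (hu : ContDiff ℝ (⊤ : ℕ∞) u) (α : Fin d → ℕ) :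
    ContDiff ℝ (⊤ : ℕ∞) (pdAlpha α u) :=
  hu.foldr_pd α _

lemma ContDiff.xGrad {d : ℕ} {u : Euc d → ℂ} (hu : ContDiff ℝ (⊤ : ℕ∞) u) :
    ContDiff ℝ (⊤ : ℕ∞) (xGrad u) := by
  refine ContDiff.sum fun j _ => ContDiff.mul ?_ (hu.pd j)
  exact Complex.ofRealCLM.contDiff.comp (EuclideanSpace.proj (𝕜 := ℝ) j).contDiff

lemma pd_comm {d : ℕ} {u : Euc d → ℂ} (hu : ContDiff ℝ (⊤ : ℕ∞) u) (i j : Fin d) :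
    pd i (pd j u) = pd j (pd i u) := by
  ext x
  have h : Differentiable ℝ (fderiv ℝ u) :=
    (hu.fderiv_right (m := 1) (by norm_cast)).differentiable (by simp)
  have key : ∀ k l : Fin d, pd k (pd l u) x =
      fderiv ℝ (fderiv ℝ u) x (EuclideanSpace.single k 1) (EuclideanSpace.single l 1) := by
    intro k l
    have hd := (h x).hasFDerivAt.clm_apply
      (hasFDerivAt_const (EuclideanSpace.single l (1 : ℝ)) x)
    have he : pd l u = fun y => fderiv ℝ u y (EuclideanSpace.single l 1) := rfl
    rw [he]
    change fderiv ℝ _ x _ = _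
    rw [hd.fderiv]
    simp
  rw [key, key]
  exact (hu.contDiffAt.isSymmSndFDerivAt (by simp; norm_cast)) _ _

lemma pd_iterate_comm {d : ℕ} {u : Euc d → ℂ} (hu : ContDiff ℝ (⊤ : ℕ∞) u) (i j : Fin d)
    (k : ℕ) : pd i ((pd j)^[k] u) = (pd j)^[k] (pd i u) := by
  induction k with
  | zero => rfl
  | succ k ih =>
    rw [Function.iterate_succ_apply', pd_comm (hu.iterate_pd j k), ih,
      Function.iterate_succ_apply']

lemma pd_add_const_mul {d : ℕ} {u v : Euc d → ℂ} (hu : ContDiff ℝ (⊤ : ℕ∞) u)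
    (hv : ContDiff ℝ (⊤ : ℕ∞) v) (i : Fin d) (c : ℂ) :
    pd i (fun x => u x + c * v x) = fun x => pd i u x + c * pd i v x := by
  ext x
  have h1 := (hu.differentiable (by simp) x).hasFDerivAt
  have h2 := (hv.differentiable (by simp) x).hasFDerivAt
  change fderiv ℝ _ x _ = _
  rw [(h1.fun_add (h2.const_mul c)).fderiv]
  simp [pd]

lemma pd_xGrad {d : ℕ} {u : Euc d → ℂ} (hu : ContDiff ℝ (⊤ : ℕ∞) u) (i : Fin d) :
    pd i (xGrad u) = fun x => xGrad (pd i u) x + pd i u x := by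
  ext x
  have hx : ∀ j : Fin d, HasFDerivAt (fun y : Euc d => ((y j : ℝ) : ℂ))
      (Complex.ofRealCLM ∘L EuclideanSpace.proj (𝕜 := ℝ) j) x := fun j =>
    (Complex.ofRealCLM ∘L EuclideanSpace.proj (𝕜 := ℝ) j).hasFDerivAt
  have hs := HasFDerivAt.fun_sum (u := Finset.univ) fun (j : Fin d) _ =>
    (hx j).fun_mul ((hu.pd j).differentiable (by simp) x).hasFDerivAt
  change fderiv ℝ (fun y => ∑ j, (y j : ℂ) * pd j u y) x _ = _
  rw [hs.fderiv]
  simp only [_root_.sum_apply, _root_.add_apply, _root_.smul_apply, smul_eq_mul,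
    ContinuousLinearMap.comp_apply, Complex.ofRealCLM_apply,
    Finset.sum_add_distrib, xGrad]
  congr 1
  · refine Finset.sum_congr rfl fun j _ => ?_
    rw [← pd_comm hu i j]
    rfl
  · rw [Finset.sum_eq_single i] <;> simp +contextual

lemma iterate_pd_xGrad_add {d : ℕ} {u : Euc d → ℂ} (hu : ContDiff ℝ (⊤ : ℕ∞) u) (i : Fin d)
    (c k : ℕ) :
    (pd i)^[k] (fun x => xGrad u x + (c : ℂ) * u x) =
      fun x => xGrad ((pd i)^[k] u) x + ((k + c : ℕ) : ℂ) * (pd i)^[k] u x := by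
  induction k with
  | zero => simp
  | succ k ih =>
    have hk := hu.iterate_pd i k
    rw [Function.iterate_succ_apply', ih, pd_add_const_mul hk.xGrad hk, pd_xGrad hk,
      Function.iterate_succ_apply']
    ext x
    push_cast
    ring

lemma foldr_pd_xGrad {d : ℕ} {u : Euc d → ℂ} (hu : ContDiff ℝ (⊤ : ℕ∞) u) (α : Fin d → ℕ)
    (L : List (Fin d)) :
    L.foldr (fun j v => (pd j)^[α j] v) (xGrad u) =
      fun x => xGrad (L.foldr (fun j v => (pd j)^[α j] v) u) x +
        (((L.map α).sum : ℕ) : ℂ) * L.foldr (fun j v => (pd j)^[α j] v) u x := by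
  induction L with
  | nil => simp
  | cons i L ih =>
    simp only [List.foldr_cons, List.map_cons, List.sum_cons]
    rw [ih, iterate_pd_xGrad_add (hu.foldr_pd α L)]

lemma pdAlpha_xGrad {d : ℕ} {u : Euc d → ℂ} (hu : ContDiff ℝ (⊤ : ℕ∞) u) (α : Fin d → ℕ) :
    pdAlpha α (xGrad u) =
      fun x => xGrad (pdAlpha α u) x + ((∑ i, α i : ℕ) : ℂ) * pdAlpha α u x := by
  have h := foldr_pd_xGrad hu α (List.finRange d)
  have hs : ((List.finRange d).map α).sum = ∑ i, α i := by
    rw [← List.ofFn_eq_map, List.sum_ofFn]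
  rw [hs] at h
  exact h

lemma foldr_pd_update_of_notMem {d : ℕ} (u : Euc d → ℂ) (α : Fin d → ℕ) (j : Fin d) (k : ℕ)
    {L : List (Fin d)} (hj : j ∉ L) :
    L.foldr (fun i v => (pd i)^[Function.update α j k i] v) u =
      L.foldr (fun i v => (pd i)^[α i] v) u := by
  induction L with
  | nil => rfl
  | cons i L ih =>
    rw [List.mem_cons, not_or] at hj
    rw [List.foldr_cons, List.foldr_cons, ih hj.2, Function.update_of_ne (Ne.symm hj.1)]

lemma pd_foldr_pd {d : ℕ} {u : Euc d → ℂ} (hu : ContDiff ℝ (⊤ : ℕ∞) u) (α : Fin d → ℕ)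
    (j : Fin d) {L : List (Fin d)} (hL : L.Nodup) (hj : j ∈ L) :
    pd j (L.foldr (fun i v => (pd i)^[α i] v) u) =
      L.foldr (fun i v => (pd i)^[Function.update α j (α j + 1) i] v) u := by
  induction L with
  | nil => simp at hj
  | cons i L ih =>
    rw [List.nodup_cons] at hL
    rw [List.foldr_cons, List.foldr_cons]
    by_cases hij : j = i
    · subst hij
      rw [foldr_pd_update_of_notMem u α j _ hL.1, Function.update_self,
        Function.iterate_succ_apply']
    · rw [pd_iterate_comm (hu.foldr_pd α L), ih hL.2 (by simpa [hij] using hj),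
        Function.update_of_ne (Ne.symm hij)]

lemma pd_pdAlpha {d : ℕ} {u : Euc d → ℂ} (hu : ContDiff ℝ (⊤ : ℕ∞) u) (α : Fin d → ℕ)
    (j : Fin d) : pd j (pdAlpha α u) = pdAlpha (Function.update α j (α j + 1)) u :=
  pd_foldr_pd hu α j (List.nodup_finRange d) (List.mem_finRange j)

lemma sum_update_succ {d : ℕ} (α : Fin d → ℕ) (j : Fin d) :
    ∑ i, Function.update α j (α j + 1) i = ∑ i, α i + 1 := by
  rw [Finset.sum_update_of_mem (Finset.mem_univ j),
    ← Finset.add_sum_erase _ α (Finset.mem_univ j), Finset.sdiff_singleton_eq_erase]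
  ring

lemma jap_pos {d : ℕ} (x : Euc d) : 0 < jap x :=
  Real.sqrt_pos.2 (by positivity)

lemma one_le_jap {d : ℕ} (x : Euc d) : 1 ≤ jap x :=
  Real.one_le_sqrt.2 (by nlinarith [sq_nonneg ‖x‖])

lemma abs_apply_le_jap {d : ℕ} (x : Euc d) (j : Fin d) : |x j| ≤ jap x := by
  have h : ‖x j‖ ≤ ‖x‖ := PiLp.norm_apply_le x j
  rw [Real.norm_eq_abs] at h
  exact h.trans (Real.le_sqrt_of_sq_le (by linarith))

/-- Symbol estimates of order `-s` with constant `M` for the derivatives of order at most `k`. -/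
def SymbolBound {d : ℕ} (s M : ℝ) (k : ℕ) (u : Euc d → ℂ) : Prop :=
  ContDiff ℝ (⊤ : ℕ∞) u ∧ ∀ α : Fin d → ℕ, ∑ i, α i ≤ k → ∀ x : Euc d,
    ‖pdAlpha α u x‖ ≤ M * jap x ^ (-(s + (∑ i, α i : ℕ)))

lemma SymbolBound.xGrad {d k : ℕ} {s M : ℝ} {u : Euc d → ℂ} (hu : SymbolBound s M (k + 1) u) :
    SymbolBound s ((d + k) * M) k (xGrad u) := by
  refine ⟨hu.1.xGrad, fun α hα x => ?_⟩
  have hJ := jap_pos x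
  have hM : 0 ≤ M := by
    have h := (norm_nonneg _).trans (hu.2 α (by omega) x)
    exact nonneg_of_mul_nonneg_left h (Real.rpow_pos_of_pos hJ _)
  rw [pdAlpha_xGrad hu.1]
  have hgrad : ‖_root_.xGrad (pdAlpha α u) x‖ ≤
      d * (M * jap x ^ (-(s + (∑ i, α i : ℕ)))) := by
    refine (norm_sum_le _ _).trans ?_
    have hterm : ∀ j ∈ (Finset.univ : Finset (Fin d)),
        ‖(x j : ℂ) * pd j (pdAlpha α u) x‖ ≤ M * jap x ^ (-(s + (∑ i, α i : ℕ))) := by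
      intro j _
      have h := hu.2 (Function.update α j (α j + 1)) (by rw [sum_update_succ]; omega) x
      rw [sum_update_succ] at h
      rw [pd_pdAlpha hu.1, norm_mul, Complex.norm_real, Real.norm_eq_abs]
      refine (mul_le_mul (abs_apply_le_jap x j) h (norm_nonneg _) hJ.le).trans_eq ?_
      have he : -(s + ((∑ i, α i : ℕ) : ℝ)) = -(s + ((∑ i, α i + 1 : ℕ) : ℝ)) + 1 := by
        push_cast; ring
      rw [he, Real.rpow_add_one hJ.ne']
      ring
    simpa using Finset.sum_le_card_nsmul _ _ _ hterm
  have hzero : ‖((∑ i, α i : ℕ) : ℂ) * pdAlpha α u x‖ ≤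
      k * (M * jap x ^ (-(s + (∑ i, α i : ℕ)))) := by
    rw [norm_mul, Complex.norm_natCast]
    exact mul_le_mul (by exact_mod_cast hα) (hu.2 α (by omega) x) (norm_nonneg _)
      (Nat.cast_nonneg k)
  exact ((norm_add_le _ _).trans (add_le_add hgrad hzero)).trans_eq (by ring)

lemma SymbolBound.mono {d k l : ℕ} {s M : ℝ} {u : Euc d → ℂ} (hu : SymbolBound s M l u)
    (hkl : k ≤ l) : SymbolBound s M k u :=
  ⟨hu.1, fun α hα => hu.2 α (hα.trans hkl)⟩

lemma SymbolBound.exists_iterate_xGrad (d k n : ℕ) :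
    ∃ D : ℝ, 0 ≤ D ∧ ∀ (s M : ℝ) (u : Euc d → ℂ), SymbolBound s M (k + n) u →
      SymbolBound s (D * M) k ((_root_.xGrad (d := d))^[n] u) := by
  induction n with
  | zero => exact ⟨1, zero_le_one, fun s M u hu => by simpa using hu⟩
  | succ n ih =>
    obtain ⟨D, hD, h⟩ := ih
    refine ⟨D * (d + (k + n : ℕ)), by positivity, fun s M u hu => ?_⟩
    rw [Function.iterate_succ_apply, mul_assoc]
    exact h _ _ _ (SymbolBound.xGrad hu)

lemma continuous_jap_rpow {d : ℕ} (t : ℝ) : Continuous fun x : Euc d => jap x ^ t := by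
  have h : Continuous fun x : Euc d => jap x := by unfold jap; fun_prop
  exact h.rpow_const fun x => Or.inl (jap_pos x).ne'

lemma eLpNorm_jap_rpow_ne_top {d : ℕ} (hd : 0 < d) {μ : ℝ} (hμ : 0 < μ) (m : ℕ) :
    eLpNorm (fun x : Euc d => jap x ^ (-(μ + m))) ((d : ℝ≥0∞) / (m : ℝ≥0∞)) volume ≠ ⊤ := by
  rcases Nat.eq_zero_or_pos m with rfl | hm
  · have htop : (d : ℝ≥0∞) / ((0 : ℕ) : ℝ≥0∞) = ⊤ := by
      rw [Nat.cast_zero, ENNReal.div_zero (by exact_mod_cast hd.ne')]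
    rw [htop, eLpNorm_exponent_top]
    refine ne_top_of_le_ne_top ENNReal.coe_ne_top
      (eLpNormEssSup_le_of_ae_nnnorm_bound (C := 1) (.of_forall fun x => ?_))
    rw [← NNReal.coe_le_coe, coe_nnnorm, Real.norm_eq_abs,
      abs_of_pos (Real.rpow_pos_of_pos (jap_pos x) _)]
    exact Real.rpow_le_one_of_one_le_of_nonpos (one_le_jap x) (by simp; linarith)
  · have hm' : (0 : ℝ) < m := by exact_mod_cast hm
    have hd' : (0 : ℝ) < d := by exact_mod_cast hd
    have hp0 : (d : ℝ≥0∞) / (m : ℝ≥0∞) ≠ 0 := by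
      simp [ENNReal.div_eq_zero_iff, hd.ne']
    have hpt : (d : ℝ≥0∞) / (m : ℝ≥0∞) ≠ ⊤ :=
      ENNReal.div_ne_top (by simp) (by exact_mod_cast hm.ne')
    have hlt : (Module.finrank ℝ (Euc d) : ℝ) < (μ + m) * (d / m) := by
      rw [finrank_euclideanSpace_fin]
      have : (μ + m) * (d / m) = μ * (d / m) + d := by field_simp
      rw [this]
      have : 0 < μ * (d / m : ℝ) := by positivity
      linarith
    have hint := integrable_rpow_neg_one_add_norm_sq (μ := (volume : Measure (Euc d))) hlt
    have hmem : MemLp (fun x : Euc d => jap x ^ (-(μ + m))) ((d : ℝ≥0∞) / (m : ℝ≥0∞)) volume := by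
      rw [← integrable_norm_rpow_iff (continuous_jap_rpow _).aestronglyMeasurable hp0 hpt]
      refine hint.congr (.of_forall fun x => ?_)
      have hb : (0 : ℝ) ≤ 1 + ‖x‖ ^ 2 := by positivity
      simp only [ENNReal.toReal_div, ENNReal.toReal_natCast]
      rw [Real.norm_eq_abs, abs_of_pos (Real.rpow_pos_of_pos (jap_pos x) _),
        ← Real.rpow_mul (jap_pos x).le, jap, Real.sqrt_eq_rpow, ← Real.rpow_mul hb]
      congr 1
      ring
    exact hmem.2.ne

lemma eLpNorm_le_of_norm_le_jap {d : ℕ} {f : Euc d → ℂ} {M t : ℝ} (p : ℝ≥0∞)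
    (hf : ∀ x, ‖f x‖ ≤ M * jap x ^ t) :
    eLpNorm f p volume ≤ ENNReal.ofReal M * eLpNorm (fun x : Euc d => jap x ^ t) p volume := by
  refine eLpNorm_le_mul_eLpNorm_of_ae_le_mul (.of_forall fun x => ?_) p
  rw [Real.norm_eq_abs, abs_of_pos (Real.rpow_pos_of_pos (jap_pos x) _)]
  exact hf x

lemma mem_multiIndices {d r : ℕ} {α : Fin d → ℕ} : α ∈ multiIndices d r ↔ ∑ i, α i ≤ r := by
  simp only [multiIndices, Finset.mem_filter, Fintype.mem_piFinset, Finset.mem_range,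
    and_iff_right_iff_imp]
  intro h i
  exact Nat.lt_succ_of_le ((Finset.single_le_sum (fun _ _ => Nat.zero_le _)
    (Finset.mem_univ i)).trans h)

/-- The symbol seminorm `max_{|α| ≤ k} sup_x ⟨x⟩^{s+|α|} |∂^α a(x)|`. -/
def symbolSeminorm {d : ℕ} (s : ℝ) (k : ℕ) (a : Euc d → ℂ) : ℝ≥0∞ :=
  (multiIndices d k).sup fun α : Fin d → ℕ =>
    ⨆ x : Euc d, ENNReal.ofReal (jap x ^ (s + (∑ i, α i : ℕ)) * ‖pdAlpha α a x‖)

lemma symbolSeminorm_ne_top {d : ℕ} {s : ℝ} (k : ℕ) {a : Euc d → ℂ}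
    (h : ∀ α : Fin d → ℕ, ∃ Cα : ℝ, 0 < Cα ∧ ∀ x : Euc d,
      ‖pdAlpha α a x‖ ≤ Cα * jap x ^ (-(s + (∑ i, α i : ℕ)))) :
    symbolSeminorm s k a ≠ ⊤ := by
  rw [symbolSeminorm, ← lt_top_iff_ne_top, Finset.sup_lt_iff (by simp)]
  intro α _
  obtain ⟨C, -, hC⟩ := h α
  refine (iSup_le fun x => ENNReal.ofReal_le_ofReal (q := C) ?_).trans_lt ENNReal.ofReal_lt_top
  have hJ := Real.rpow_pos_of_pos (jap_pos x) (s + (∑ i, α i : ℕ))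
  have := hC x
  rw [Real.rpow_neg (jap_pos x).le, ← div_eq_mul_inv, le_div_iff₀ hJ] at this
  linarith

lemma symbolBound_of_symbolSeminorm_ne_top {d k : ℕ} {s : ℝ} {a : Euc d → ℂ}
    (ha : ContDiff ℝ (⊤ : ℕ∞) a) (h : symbolSeminorm s k a ≠ ⊤) :
    SymbolBound s (symbolSeminorm s k a).toReal k a := by
  refine ⟨ha, fun α hα x => ?_⟩
  have hle : ENNReal.ofReal (jap x ^ (s + (∑ i, α i : ℕ)) * ‖pdAlpha α a x‖) ≤
      symbolSeminorm s k a :=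
    (le_iSup (fun x : Euc d =>
      ENNReal.ofReal (jap x ^ (s + (∑ i, α i : ℕ)) * ‖pdAlpha α a x‖)) x).trans
      (Finset.le_sup (f := fun α : Fin d → ℕ => ⨆ x : Euc d,
        ENNReal.ofReal (jap x ^ (s + (∑ i, α i : ℕ)) * ‖pdAlpha α a x‖)) (mem_multiIndices.2 hα))
  have hJ := Real.rpow_pos_of_pos (jap_pos x) (s + (∑ i, α i : ℕ))
  rw [Real.rpow_neg (jap_pos x).le, ← div_eq_mul_inv, le_div_iff₀ hJ, mul_comm]
  exact (ENNReal.ofReal_le_iff_le_toReal h).1 hle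

/-- Symbol class embeddings `S^{-μ-o} ⊂ S^{o,r-o,N}`: if
`|∂^α a(x)| ≤ C_α ⟨x⟩^{-μ-o-|α|}` for every multi-index `α`, then `‖a‖_{o,r-o,N} < ∞`, and
`‖a‖_{o,r-o,N} ≤ C · max_{|α| ≤ N+r-o} sup_x ⟨x⟩^{μ+o+|α|} |∂^α a(x)|` with `C` depending only
on `d, r, N, μ, o`. -/
theorem statement14 (d : ℕ) (hd : 3 ≤ d) (o r N : ℕ) (ho : o ≤ 1) (hor : o ≤ r)
    (hr1 : 1 ≤ r) (hr : r ≤ rbar d) (μ : ℝ) (hμ : 0 < μ) :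
    ∃ C : ℝ, 0 < C ∧
      ∀ a : Euc d → ℂ, ContDiff ℝ (⊤ : ℕ∞) a →
        (∀ α : Fin d → ℕ, ∃ Cα : ℝ, 0 < Cα ∧ ∀ x : Euc d,
            ‖pdAlpha α a x‖ ≤ Cα * jap x ^ (-(μ + o + (∑ i, α i : ℕ)))) →
        coefNorm d o (r - o) N a ≠ ⊤ ∧
        coefNorm d o (r - o) N a ≤
          ENNReal.ofReal C *
            (multiIndices d (N + r - o)).sup (fun α : Fin d → ℕ =>
              ⨆ x : Euc d,
                ENNReal.ofReal (jap x ^ ((μ + o + (∑ i, α i : ℕ) : ℝ)) * ‖pdAlpha α a x‖)) := by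
  choose D hD0 hD using SymbolBound.exists_iterate_xGrad d (r - o)
  let K : (Fin d → ℕ) → ℝ≥0∞ := fun α =>
    eLpNorm (fun x : Euc d => jap x ^ (-(μ + (o + ∑ i, α i : ℕ))))
      ((d : ℝ≥0∞) / ((o + ∑ i, α i : ℕ) : ℝ≥0∞)) volume
  have hK : ∀ α, K α ≠ ⊤ := fun α => eLpNorm_jap_rpow_ne_top (by omega) hμ _
  let T : ℝ≥0∞ := ∑ n ∈ Finset.range (N + 1), ∑ α ∈ multiIndices d (r - o),
    ENNReal.ofReal (D n) * K α
  have hT : T ≠ ⊤ := ENNReal.sum_ne_top.2 fun n _ => ENNReal.sum_ne_top.2 fun α _ =>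
    ENNReal.mul_ne_top ENNReal.ofReal_ne_top (hK α)
  refine ⟨T.toReal + 1, by positivity, fun a ha hbound => ?_⟩
  have hS : symbolSeminorm (μ + o) (N + r - o) a ≠ ⊤ := symbolSeminorm_ne_top _ hbound
  have hle : coefNorm d o (r - o) N a ≤
      ENNReal.ofReal (T.toReal + 1) * symbolSeminorm (μ + o) (N + r - o) a := by
    have hTS : coefNorm d o (r - o) N a ≤ T * symbolSeminorm (μ + o) (N + r - o) a := by
      simp only [coefNorm, T, Finset.sum_mul]
      refine Finset.sum_le_sum fun n hn => Finset.sum_le_sum fun α hα => ?_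
      rw [Finset.mem_range] at hn
      have hsym := hD n _ _ _
        ((symbolBound_of_symbolSeminorm_ne_top ha hS).mono (k := r - o + n) (by omega))
      have hpt := hsym.2 α (mem_multiIndices.1 hα)
      have he : μ + o + ((∑ i, α i : ℕ) : ℝ) = μ + (o + ∑ i, α i : ℕ) := by push_cast; ring
      rw [he] at hpt
      refine (eLpNorm_le_of_norm_le_jap _ hpt).trans_eq ?_
      rw [ENNReal.ofReal_mul (hD0 n), ENNReal.ofReal_toReal hS]
      exact mul_right_comm _ _ _
    refine hTS.trans (mul_le_mul_left ?_ _)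
    exact (ENNReal.ofReal_toReal hT).ge.trans (ENNReal.ofReal_le_ofReal (by linarith))
  exact ⟨ne_top_of_le_ne_top (ENNReal.mul_ne_top ENNReal.ofReal_ne_top hS) hle, hle⟩
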